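/- arXiv:2203.12922 — 2 statements merged into one kernel-verified Lean document; each statement's English description precedes it below -/
import Mathlib

section
/- For every finite Markov decision process, every horizon d ≥ 1 and every state-action pair (s,a), the maximum over stationary policies of the expected number of visits to (s,a) within d steps starting from s is at least one sixth of the maximum over all (possibly non-stationary) deterministic policies: max_{π ∈ Π_sta} W^π_d(1_{s,a}, P, 1_s) ≥ (1/6) · max_{π ∈ Π} W^π_d(1_{s,a}, P, 1_s). -/
open scoped Classical BigOperators

/-- `val P r d π s` is the expected total reward `E[Σ_{h=1}^d r(s_h,a_h)]` collected in `d`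
steps, following the (possibly non-stationary) deterministic policy `π` under the transition
kernel `P`, starting from state `s`. -/
noncomputable def val {S A : Type*} [Fintype S] (P : S → A → S → ℝ)
    (r : S → A → ℝ) : ℕ → (ℕ → S → A) → S → ℝ
  | 0, _, _ => 0
  | d + 1, π, s =>
      r s (π 0 s) + ∑ s' : S, P s (π 0 s) s' * val P r d (fun h => π (h + 1)) s'

/-- The indicator reward `1_{s,a}`. -/
noncomputable def ind {S A : Type*} (s : S) (a : A) : S → A → ℝ :=
  fun s' a' => if s' = s ∧ a' = a then 1 else 0

/-- The value of a nonnegative reward is nonnegative. -/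
theorem val_nonneg {S A : Type*} [Fintype S] {P : S → A → S → ℝ} {r : S → A → ℝ}
    (hP0 : ∀ s a s', 0 ≤ P s a s') (hr : ∀ s a, 0 ≤ r s a) (d : ℕ) (π : ℕ → S → A) (x : S) :
    0 ≤ val P r d π x := by
  induction d generalizing π x with
  | zero => exact le_rfl
  | succ d ih =>
    exact add_nonneg (hr _ _) (Finset.sum_nonneg fun y _ => mul_nonneg (hP0 _ _ _) (ih _ _))

/-- Averages against a probability vector are at most any upper bound of the averaged function. -/
theorem sum_mul_le_of_le {S : Type*} [Fintype S] {p f : S → ℝ} {c : ℝ} (hp0 : ∀ x, 0 ≤ p x)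
    (hp1 : ∑ x, p x = 1) (hf : ∀ x, f x ≤ c) : ∑ x, p x * f x ≤ c := by
  calc ∑ x, p x * f x ≤ ∑ x, p x * c :=
        Finset.sum_le_sum fun x _ => mul_le_mul_of_nonneg_left (hf x) (hp0 x)
    _ = c := by rw [← Finset.sum_mul, hp1, one_mul]

/-- The discounted Bellman optimality equation has a solution, attained by a greedy stationary
policy. -/
theorem exists_bellman_solution {S A : Type*} [Fintype S] [Fintype A] [Nonempty A]
    {P : S → A → S → ℝ} (hP0 : ∀ s a s', 0 ≤ P s a s') (hP1 : ∀ s a, ∑ s' : S, P s a s' = 1)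
    (r : S → A → ℝ) {γ : ℝ} (hγ0 : 0 ≤ γ) (hγ1 : γ < 1) :
    ∃ (V : S → ℝ) (π : S → A),
      (∀ x b, r x b + γ * ∑ y, P x b y * V y ≤ V x) ∧
      ∀ x, V x = r x (π x) + γ * ∑ y, P x (π x) y * V y := by
  let Q : (S → ℝ) → S → A → ℝ := fun V x b => r x b + γ * ∑ y, P x b y * V y
  let T : (S → ℝ) → S → ℝ := fun V x => Finset.univ.sup' Finset.univ_nonempty (Q V x)
  have key (V W : S → ℝ) (x : S) : T V x ≤ T W x + γ * dist V W := by
    refine Finset.sup'_le _ _ fun b _ => ?_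
    have h1 : Q W x b ≤ T W x := Finset.le_sup' (Q W x) (Finset.mem_univ b)
    have h2 : ∑ y, P x b y * (V y - W y) ≤ dist V W :=
      sum_mul_le_of_le (hP0 x b) (hP1 x b) fun y =>
        (le_abs_self _).trans (by simpa [Real.dist_eq] using dist_le_pi_dist V W y)
    have h3 : Q V x b = Q W x b + γ * ∑ y, P x b y * (V y - W y) := by
      simp only [Q, mul_sub, Finset.sum_sub_distrib]
      ring
    have h4 := mul_le_mul_of_nonneg_left h2 hγ0
    linarith
  have hT : ContractingWith ⟨γ, hγ0⟩ T := by
    refine ⟨hγ1, LipschitzWith.of_dist_le_mul fun V W => ?_⟩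
    refine (dist_pi_le_iff (mul_nonneg hγ0 dist_nonneg)).2 fun x => ?_
    have h1 := key V W x
    have h2 := key W V x
    rw [dist_comm W V] at h2
    rw [Real.dist_eq, abs_le]
    change -(γ * dist V W) ≤ _ ∧ _ ≤ γ * dist V W
    constructor <;> linarith
  let V := hT.fixedPoint T
  have hV : T V = V := hT.fixedPoint_isFixedPt
  have hmax (x : S) : ∃ b, T V x = Q V x b := by
    obtain ⟨b, -, hb⟩ := Finset.exists_mem_eq_sup' Finset.univ_nonempty (Q V x)
    exact ⟨b, hb⟩
  choose π hπ using hmax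
  refine ⟨V, π, fun x b => ?_, fun x => ?_⟩
  · exact (Finset.le_sup' (Q V x) (Finset.mem_univ b)).trans (congrFun hV x).le
  · exact (congrFun hV x).symm.trans (hπ x)

/-- For every horizon `d ≥ 1` and every state-action pair `(s,a)`, the maximum over stationary
policies of the expected number of visits to `(s,a)` within `d` steps starting from `s` is at
least one sixth of the maximum over all (possibly non-stationary) deterministic policies. -/
theorem stationary_one_sixth {S A : Type*} [Fintype S] [Fintype A] [Nonempty A]
    (P : S → A → S → ℝ)
    (hP0 : ∀ s a s', 0 ≤ P s a s') (hP1 : ∀ s a, ∑ s' : S, P s a s' = 1)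
    (s : S) (a : A) (d : ℕ) (hd : 1 ≤ d) (π : ℕ → S → A) :
    ∃ π' : S → A,
      (1 / 6 : ℝ) * val P (ind s a) d π s ≤ val P (ind s a) d (fun _ => π') s := by
  have hd0 : d ≠ 0 := by omega
  obtain ⟨γ, hγ0, hγd⟩ : ∃ γ : ℝ, 0 ≤ γ ∧ γ ^ d = 1 / 2 :=
    ⟨(1 / 2) ^ (d⁻¹ : ℝ), by positivity, Real.rpow_inv_natCast_pow (by norm_num) hd0⟩
  have hγ1 : γ < 1 := by
    by_contra! h
    have := one_le_pow₀ h (n := d)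
    linarith
  have hr0 (x : S) (b : A) : 0 ≤ ind s a x b := by unfold ind; split_ifs <;> norm_num
  obtain ⟨V, π', hVle, hVeq⟩ := exists_bellman_solution hP0 hP1 (ind s a) hγ0 hγ1
  have : Nonempty S := ⟨s⟩
  have hV0 (x : S) : 0 ≤ V x := by
    obtain ⟨m, hm⟩ := Finite.exists_min V
    have h1 : ∑ y, P m (π' m) y * -V y ≤ -V m :=
      sum_mul_le_of_le (hP0 _ _) (hP1 _ _) fun y => neg_le_neg (hm y)
    simp only [mul_neg, Finset.sum_neg_distrib] at h1
    have h2 := hVeq m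
    have h3 := hr0 m (π' m)
    refine le_trans ?_ (hm x)
    nlinarith
  have hVs (x : S) : V x ≤ V s := by
    obtain ⟨m, hm⟩ := Finite.exists_max V
    by_cases hms : m = s
    · exact hms ▸ hm x
    · have h1 : ∑ y, P m (π' m) y * V y ≤ V m := sum_mul_le_of_le (hP0 _ _) (hP1 _ _) hm
      have h2 := hVeq m
      have h3 : ind s a m (π' m) = 0 := by simp [ind, hms]
      have h4 : V m ≤ 0 := by nlinarith
      exact (hm x).trans (h4.trans (hV0 s))
  have hlower (n : ℕ) (σ : ℕ → S → A) (x : S) : γ ^ n * val P (ind s a) n σ x ≤ V x := by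
    induction n generalizing σ x with
    | zero => simpa [val] using hV0 x
    | succ n ih =>
      refine le_trans ?_ (hVle x (σ 0 x))
      have h1 : γ ^ (n + 1) * ind s a x (σ 0 x) ≤ ind s a x (σ 0 x) :=
        mul_le_of_le_one_left (hr0 _ _) (pow_le_one₀ hγ0 hγ1.le)
      have h2 : γ ^ n * ∑ y, P x (σ 0 x) y * val P (ind s a) n (fun h => σ (h + 1)) y ≤
          ∑ y, P x (σ 0 x) y * V y := by
        rw [Finset.mul_sum]
        refine Finset.sum_le_sum fun y _ => ?_
        rw [mul_left_comm]
        exact mul_le_mul_of_nonneg_left (ih _ y) (hP0 _ _ _)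
      have h3 := mul_le_mul_of_nonneg_left h2 hγ0
      rw [val, mul_add]
      refine add_le_add h1 ?_
      rw [pow_succ', mul_assoc]
      exact h3
  have hupper (n : ℕ) (x : S) : V x ≤ val P (ind s a) n (fun _ => π') x + γ ^ n * V s := by
    induction n generalizing x with
    | zero => simpa [val] using hVs x
    | succ n ih =>
      have h1 : ∑ y, P x (π' x) y * (V y - val P (ind s a) n (fun _ => π') y) ≤ γ ^ n * V s :=
        sum_mul_le_of_le (hP0 _ _) (hP1 _ _) fun y => by linarith [ih y]
      simp only [mul_sub, Finset.sum_sub_distrib] at h1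
      have h2 : 0 ≤ ∑ y, P x (π' x) y * val P (ind s a) n (fun _ => π') y :=
        Finset.sum_nonneg fun y _ => mul_nonneg (hP0 _ _ _) (val_nonneg hP0 hr0 _ _ _)
      have h3 := mul_le_mul_of_nonneg_left h1 hγ0
      have h4 := mul_le_of_le_one_left h2 hγ1.le
      rw [hVeq x, val, pow_succ', mul_assoc]
      linarith
  refine ⟨π', ?_⟩
  have h1 := hlower d π s
  have h2 := hupper d s
  have h3 := val_nonneg hP0 hr0 d π s
  rw [hγd] at h1 h2
  linarith
end

section
/- Let d₂ be a positive integer and set γ = 1 − 1/d₂. For any transition kernel p on a finite MDP, any state-action pair (s,a), any non-negative reward function r, and any stationary policy π: (i) (1/3) · W^π_{d₂}(1_{s,a}, p, 1_s) ≤ W^π_γ(1_{s,a}, p, 1_s) ≤ 3 · W^π_{d₂}(1_{s,a}, p, 1_s); and (ii) W^π_γ(r, p, 1_s) ≥ (1/3) · W^π_{d₂}(r, p, 1_s). -/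
open scoped Classical BigOperators

/-- Distribution of the state at step `n+1` (0-indexed `n`), following the stationary policy
`π` under the transition kernel `p`, starting from the initial distribution `μ`. -/
noncomputable def stepDist {S A : Type*} [Fintype S] (p : S → A → S → ℝ) (π : S → A)
    (μ : S → ℝ) : ℕ → S → ℝ
  | 0, s => μ s
  | n + 1, s' => ∑ s : S, stepDist p π μ n s * p s (π s) s'

/-- Expected reward collected at step `n+1` (0-indexed `n`). -/
noncomputable def expReward {S A : Type*} [Fintype S] (p : S → A → S → ℝ) (r : S → A → ℝ)
    (π : S → A) (μ : S → ℝ) (n : ℕ) : ℝ :=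
  ∑ s : S, stepDist p π μ n s * r s (π s)

/-- Finite-horizon value `W_d^π(r, p, μ) = E[Σ_{h=1}^d r(s_h, a_h)]`. -/
noncomputable def Wfin {S A : Type*} [Fintype S] (p : S → A → S → ℝ) (r : S → A → ℝ)
    (π : S → A) (μ : S → ℝ) (d : ℕ) : ℝ :=
  ∑ n ∈ Finset.range d, expReward p r π μ n

/-- Discounted value `W_γ^π(r, p, μ) = E[Σ_{i=1}^∞ γ^{i-1} r(s_i, a_i)]`. -/
noncomputable def Wdisc {S A : Type*} [Fintype S] (p : S → A → S → ℝ) (r : S → A → ℝ)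
    (π : S → A) (μ : S → ℝ) (γ : ℝ) : ℝ :=
  ∑' n : ℕ, γ ^ n * expReward p r π μ n

/-- The Dirac initial distribution at `s`. -/
noncomputable def dirac {S : Type*} (s : S) : S → ℝ := fun s' => if s' = s then 1 else 0

theorem dirac_nonneg {S : Type*} (x s : S) : 0 ≤ dirac x s := by
  unfold dirac
  split_ifs <;> norm_num

theorem ind_nonneg {S A : Type*} (s : S) (a : A) (s' : S) (a' : A) : 0 ≤ ind s a s' a' := by
  unfold ind
  split_ifs <;> norm_num

section MarkovChain

variable {S A : Type*} [Fintype S] {p : S → A → S → ℝ} {π : S → A} {μ : S → ℝ}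

theorem stepDist_nonneg (hp0 : ∀ s a s', 0 ≤ p s a s') (hμ : ∀ s, 0 ≤ μ s) (n : ℕ) (s : S) :
    0 ≤ stepDist p π μ n s := by
  induction n generalizing s with
  | zero => exact hμ s
  | succ n ih => exact Finset.sum_nonneg fun x _ => mul_nonneg (ih x) (hp0 _ _ _)

theorem sum_stepDist (hp1 : ∀ s a, ∑ s' : S, p s a s' = 1) (n : ℕ) :
    ∑ s, stepDist p π μ n s = ∑ s, μ s := by
  induction n with
  | zero => rfl
  | succ n ih =>
    simp only [stepDist]
    rw [Finset.sum_comm]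
    simp only [← Finset.mul_sum, hp1, mul_one, ih]

theorem stepDist_add (p : S → A → S → ℝ) (π : S → A) (μ : S → ℝ) (m n : ℕ) (s : S) :
    stepDist p π μ (m + n) s = stepDist p π (stepDist p π μ m) n s := by
  induction n generalizing s with
  | zero => rfl
  | succ n ih =>
    rw [← add_assoc]
    simp only [stepDist, ih]

theorem stepDist_eq_sum_dirac (p : S → A → S → ℝ) (π : S → A) (μ : S → ℝ) (n : ℕ) (s : S) :
    stepDist p π μ n s = ∑ x, μ x * stepDist p π (dirac x) n s := by
  induction n generalizing s with
  | zero => simp [stepDist, dirac]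
  | succ n ih =>
    simp only [stepDist, Finset.mul_sum, ← mul_assoc]
    rw [Finset.sum_comm]
    simp only [← Finset.sum_mul, ← ih]

theorem stepDist_dirac_succ (p : S → A → S → ℝ) (π : S → A) (x : S) (n : ℕ) (s : S) :
    stepDist p π (dirac x) (n + 1) s = stepDist p π (p x (π x)) n s := by
  have h : stepDist p π (dirac x) 1 = p x (π x) := by
    funext y
    simp [stepDist, dirac]
  rw [add_comm, stepDist_add, h]

theorem sum_dirac (x : S) : ∑ s, dirac x s = 1 := by
  simp [dirac]

/-- Occupancy of `s` over a fixed horizon, as a sum over starting states. -/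
theorem sum_range_stepDist (p : S → A → S → ℝ) (π : S → A) (μ : S → ℝ) (s : S) (m : ℕ) :
    ∑ n ∈ Finset.range m, stepDist p π μ n s =
      ∑ x, μ x * ∑ n ∈ Finset.range m, stepDist p π (dirac x) n s := by
  simp only [Finset.mul_sum]
  rw [Finset.sum_comm]
  exact Finset.sum_congr rfl fun n _ => stepDist_eq_sum_dirac p π μ n s

/-- Among all starting distributions, starting at `s` maximizes the occupancy of `s`. -/
theorem sum_range_stepDist_le (hp0 : ∀ s a s', 0 ≤ p s a s')
    (hp1 : ∀ s a, ∑ s' : S, p s a s' = 1) (s : S) (m : ℕ) (hμ : ∀ x, 0 ≤ μ x)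
    (hμ1 : ∑ x, μ x = 1) :
    ∑ n ∈ Finset.range m, stepDist p π μ n s ≤
      ∑ n ∈ Finset.range m, stepDist p π (dirac s) n s := by
  induction m generalizing μ with
  | zero => simp
  | succ m ih =>
    have key (x : S) : ∑ n ∈ Finset.range (m + 1), stepDist p π (dirac x) n s ≤
        ∑ n ∈ Finset.range (m + 1), stepDist p π (dirac s) n s := by
      by_cases hx : x = s
      · rw [hx]
      rw [Finset.sum_range_succ', Finset.sum_range_succ _ m]
      simp only [stepDist_dirac_succ]
      have h0 : stepDist p π (dirac x) 0 s = 0 := by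
        simp [stepDist, dirac, Ne.symm hx]
      rw [h0]
      exact add_le_add (ih (hp0 _ _) (hp1 _ _)) (stepDist_nonneg hp0 (dirac_nonneg s) m s)
    rw [sum_range_stepDist]
    calc _ ≤ ∑ x, μ x * ∑ n ∈ Finset.range (m + 1), stepDist p π (dirac s) n s :=
          Finset.sum_le_sum fun x _ => mul_le_mul_of_nonneg_left (key x) (hμ x)
      _ = _ := by rw [← Finset.sum_mul, hμ1, one_mul]

theorem expReward_nonneg {r : S → A → ℝ} (hp0 : ∀ s a s', 0 ≤ p s a s') (hμ : ∀ s, 0 ≤ μ s)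
    (hr : ∀ s a, 0 ≤ r s a) (n : ℕ) : 0 ≤ expReward p r π μ n :=
  Finset.sum_nonneg fun x _ => mul_nonneg (stepDist_nonneg hp0 hμ n x) (hr _ _)

theorem expReward_le {r : S → A → ℝ} (hp0 : ∀ s a s', 0 ≤ p s a s')
    (hp1 : ∀ s a, ∑ s' : S, p s a s' = 1) (hμ : ∀ s, 0 ≤ μ s) (hμ1 : ∑ s, μ s = 1)
    (hr : ∀ s a, 0 ≤ r s a) (n : ℕ) : expReward p r π μ n ≤ ∑ s, r s (π s) := by
  refine Finset.sum_le_sum fun x _ => mul_le_of_le_one_left (hr _ _) ?_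
  rw [← hμ1, ← sum_stepDist (π := π) (μ := μ) hp1 n]
  exact Finset.single_le_sum (fun y _ => stepDist_nonneg hp0 hμ n y) (Finset.mem_univ x)

theorem expReward_ind (p : S → A → S → ℝ) (π : S → A) (μ : S → ℝ) (s : S) (a : A) (n : ℕ) :
    expReward p (ind s a) π μ n = (if π s = a then 1 else 0) * stepDist p π μ n s := by
  unfold expReward ind
  rw [Finset.sum_eq_single s (fun y _ hy => by simp [hy]) (by simp)]
  simp [mul_comm]

end MarkovChain

theorem one_third_le_one_sub_inv_pow {d n : ℕ} (hn : n < d) :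
    (1 / 3 : ℝ) ≤ (1 - 1 / (d : ℝ)) ^ n := by
  obtain ⟨k, rfl⟩ : ∃ k, d = k + 1 := ⟨d - 1, by omega⟩
  have h : (1 - 1 / ((k + 1 : ℕ) : ℝ)) = k / (k + 1) := by
    push_cast
    field_simp
    ring
  rw [h]
  have hle : (k / (k + 1) : ℝ) ≤ 1 := by
    rw [div_le_one (by positivity)]
    linarith
  refine le_trans ?_ (pow_le_pow_of_le_one (by positivity) hle (Nat.lt_succ_iff.mp hn))
  rcases Nat.eq_zero_or_pos k with rfl | hk
  · norm_num
  have hk' : (0 : ℝ) < k := by exact_mod_cast hk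
  have hinv : (k / (k + 1) : ℝ) = (1 / (k : ℝ) + 1)⁻¹ := by
    field_simp
    ring
  have hexp : (1 / (k : ℝ) + 1) ^ k ≤ 3 :=
    calc (1 / (k : ℝ) + 1) ^ k ≤ Real.exp (1 / k) ^ k :=
          pow_le_pow_left₀ (by positivity) (Real.add_one_le_exp _) k
      _ = Real.exp 1 := by
          rw [← Real.exp_nat_mul, mul_one_div_cancel hk'.ne']
      _ ≤ 3 := by linarith [Real.exp_one_lt_d9]
  rw [hinv, inv_pow, one_div]
  exact inv_anti₀ (by positivity) hexp

theorem one_sub_inv_mem_Ico {d : ℕ} (hd : 1 ≤ d) :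
    0 ≤ 1 - 1 / (d : ℝ) ∧ 1 - 1 / (d : ℝ) < 1 := by
  have hd' : (1 : ℝ) ≤ d := by exact_mod_cast hd
  have h1 : 1 / (d : ℝ) ≤ 1 := by
    rw [div_le_one (by linarith)]
    exact hd'
  have h0 : 0 < 1 / (d : ℝ) := by positivity
  constructor <;> linarith

theorem one_sub_inv_pow_le_half {d : ℕ} (hd : 1 ≤ d) :
    (1 - 1 / (d : ℝ)) ^ d ≤ 1 / 2 := by
  have hd' : (0 : ℝ) < d := by exact_mod_cast hd
  calc (1 - 1 / (d : ℝ)) ^ d ≤ Real.exp (-(1 / d)) ^ d :=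
        pow_le_pow_left₀ (one_sub_inv_mem_Ico hd).1 (Real.one_sub_le_exp_neg _) d
    _ = (Real.exp 1)⁻¹ := by
        rw [← Real.exp_nat_mul, mul_neg, mul_one_div_cancel hd'.ne', Real.exp_neg]
    _ ≤ 1 / 2 := by
        rw [one_div]
        exact inv_anti₀ (by norm_num) (by linarith [Real.exp_one_gt_d9])

/-- If every length-`d` block of `u` sums to at most `U`, the discounted sum is at most `2 U`
as soon as `γ ^ d ≤ 1 / 2`. -/
theorem tsum_pow_mul_le_of_block_le {u : ℕ → ℝ} {γ U : ℝ} {d : ℕ} (hd : 1 ≤ d)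
    (hγ0 : 0 ≤ γ) (hγ1 : γ ≤ 1) (hγd : γ ^ d ≤ 1 / 2) (hu : ∀ n, 0 ≤ u n) (hU : 0 ≤ U)
    (hblock : ∀ m, ∑ j ∈ Finset.range d, u (m + j) ≤ U) :
    ∑' n, γ ^ n * u n ≤ 2 * U := by
  have hpart (K : ℕ) :
      ∑ n ∈ Finset.range (K * d), γ ^ n * u n ≤ 2 * (1 - (γ ^ d) ^ K) * U := by
    induction K with
    | zero => simp
    | succ K ih =>
      have hstep : ∑ j ∈ Finset.range d, γ ^ (K * d + j) * u (K * d + j) ≤ (γ ^ d) ^ K * U :=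
        calc _ ≤ ∑ j ∈ Finset.range d, (γ ^ d) ^ K * u (K * d + j) := by
              refine Finset.sum_le_sum fun j _ => mul_le_mul_of_nonneg_right ?_ (hu _)
              rw [← pow_mul, mul_comm d K]
              exact pow_le_pow_of_le_one hγ0 hγ1 (Nat.le_add_right _ _)
          _ = (γ ^ d) ^ K * ∑ j ∈ Finset.range d, u (K * d + j) := by rw [Finset.mul_sum]
          _ ≤ _ := mul_le_mul_of_nonneg_left (hblock _) (by positivity)
      rw [Nat.succ_mul, Finset.sum_range_add, pow_succ]
      have hq : 0 ≤ (γ ^ d) ^ K * U := by positivity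
      nlinarith [mul_nonneg hq (sub_nonneg.mpr hγd)]
  have hterm (n : ℕ) : 0 ≤ γ ^ n * u n := mul_nonneg (pow_nonneg hγ0 n) (hu n)
  refine Real.tsum_le_of_sum_range_le hterm fun n => ?_
  calc _ ≤ ∑ i ∈ Finset.range (n * d), γ ^ i * u i :=
        Finset.sum_le_sum_of_subset_of_nonneg
          (Finset.range_mono (Nat.le_mul_of_pos_right n hd)) fun i _ _ => hterm i
    _ ≤ 2 * (1 - (γ ^ d) ^ n) * U := hpart n
    _ ≤ 2 * U := by
        have : 0 ≤ (γ ^ d) ^ n * U := by positivity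
        nlinarith

theorem one_third_mul_Wfin_le_Wdisc {S A : Type*} [Fintype S] {p : S → A → S → ℝ}
    {π : S → A} {μ : S → ℝ} {r : S → A → ℝ} (hp0 : ∀ s a s', 0 ≤ p s a s')
    (hp1 : ∀ s a, ∑ s' : S, p s a s' = 1) (hμ : ∀ s, 0 ≤ μ s) (hμ1 : ∑ s, μ s = 1)
    (hr : ∀ s a, 0 ≤ r s a) {d : ℕ} (hd : 1 ≤ d) :
    (1 / 3 : ℝ) * Wfin p r π μ d ≤ Wdisc p r π μ (1 - 1 / (d : ℝ)) := by
  obtain ⟨hγ0, hγ1⟩ := one_sub_inv_mem_Ico hd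
  have hterm (n : ℕ) : 0 ≤ (1 - 1 / (d : ℝ)) ^ n * expReward p r π μ n :=
    mul_nonneg (pow_nonneg hγ0 n) (expReward_nonneg hp0 hμ hr n)
  have hsum : Summable fun n => (1 - 1 / (d : ℝ)) ^ n * expReward p r π μ n :=
    Summable.of_nonneg_of_le hterm
      (fun n => mul_le_mul_of_nonneg_left (expReward_le hp0 hp1 hμ hμ1 hr n)
        (pow_nonneg hγ0 n))
      ((summable_geometric_of_lt_one hγ0 hγ1).mul_right _)
  refine le_trans ?_ (hsum.sum_le_tsum (Finset.range d) fun n _ => hterm n)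
  rw [Wfin, Finset.mul_sum]
  exact Finset.sum_le_sum fun n hn =>
    mul_le_mul_of_nonneg_right (one_third_le_one_sub_inv_pow (Finset.mem_range.mp hn))
      (expReward_nonneg hp0 hμ hr n)

theorem Wdisc_ind_le_two_mul_Wfin {S A : Type*} [Fintype S] {p : S → A → S → ℝ}
    (hp0 : ∀ s a s', 0 ≤ p s a s') (hp1 : ∀ s a, ∑ s' : S, p s a s' = 1)
    (s : S) (a : A) (π : S → A) {d : ℕ} (hd : 1 ≤ d) :
    Wdisc p (ind s a) π (dirac s) (1 - 1 / (d : ℝ)) ≤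
      2 * Wfin p (ind s a) π (dirac s) d := by
  obtain ⟨hγ0, hγ1⟩ := one_sub_inv_mem_Ico hd
  have hnn := expReward_nonneg (π := π) hp0 (dirac_nonneg s) (ind_nonneg s a)
  refine tsum_pow_mul_le_of_block_le hd hγ0 hγ1.le (one_sub_inv_pow_le_half hd) hnn
    (Finset.sum_nonneg fun n _ => hnn n) fun m => ?_
  simp only [Wfin, expReward_ind, ← Finset.mul_sum, stepDist_add]
  refine mul_le_mul_of_nonneg_left (sum_range_stepDist_le hp0 hp1 s d
    (stepDist_nonneg hp0 (dirac_nonneg s) m) ((sum_stepDist hp1 m).trans (sum_dirac s))) ?_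
  split_ifs <;> norm_num

/-- For `γ = 1 - 1/d₂`: (i) `(1/3)·W_{d₂}^π(1_{s,a},p,1_s) ≤ W_γ^π(1_{s,a},p,1_s)
≤ 3·W_{d₂}^π(1_{s,a},p,1_s)`, and (ii) `W_γ^π(r,p,1_s) ≥ (1/3)·W_{d₂}^π(r,p,1_s)` for any
non-negative reward `r`. -/
theorem discounted_vs_finite_horizon {S A : Type*} [Fintype S] [Fintype A]
    (p : S → A → S → ℝ)
    (hp0 : ∀ s a s', 0 ≤ p s a s') (hp1 : ∀ s a, ∑ s' : S, p s a s' = 1)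
    (s : S) (a : A) (π : S → A) (r : S → A → ℝ) (hr : ∀ s' a', 0 ≤ r s' a')
    (d₂ : ℕ) (hd₂ : 1 ≤ d₂) :
    ((1 / 3 : ℝ) * Wfin p (ind s a) π (dirac s) d₂ ≤
        Wdisc p (ind s a) π (dirac s) (1 - 1 / (d₂ : ℝ)) ∧
      Wdisc p (ind s a) π (dirac s) (1 - 1 / (d₂ : ℝ)) ≤
        3 * Wfin p (ind s a) π (dirac s) d₂) ∧
    (1 / 3 : ℝ) * Wfin p r π (dirac s) d₂ ≤ Wdisc p r π (dirac s) (1 - 1 / (d₂ : ℝ)) := by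
  have hW : 0 ≤ Wfin p (ind s a) π (dirac s) d₂ :=
    Finset.sum_nonneg fun n _ => expReward_nonneg hp0 (dirac_nonneg s) (ind_nonneg s a) n
  refine ⟨⟨one_third_mul_Wfin_le_Wdisc hp0 hp1 (dirac_nonneg s) (sum_dirac s)
    (ind_nonneg s a) hd₂, ?_⟩,
    one_third_mul_Wfin_le_Wdisc hp0 hp1 (dirac_nonneg s) (sum_dirac s) hr hd₂⟩
  linarith [Wdisc_ind_le_two_mul_Wfin hp0 hp1 s a π hd₂]
end
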